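/- Equality in the three-dimensional gravitational entropic bound holds for the Plummer profile: if ρ(x) = (3M/(4πγ³)) (1 + |x|²/γ²)^{−5/2} with M > 0, γ > 0, then G ∬_{ℝ³×ℝ³} ρ(x) ρ(y) |x−y|^{−1} dx dy = C(3,1) G M² (1 − (1/5) S_{6/5}[ρ/M])^{5/3}. -/

import Mathlib

open MeasureTheory

/-- The sharp diagonal Hardy–Littlewood–Sobolev constant for `D = 3`, `λ = 1`:
`C(3,1) = π^{1/2} Γ(1)/Γ(5/2) · (Γ(3/2)/Γ(3))^{−2/3}`. -/
noncomputable def C31 : ℝ :=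
  Real.pi ^ ((1 : ℝ) / 2) * (Real.Gamma 1 / Real.Gamma (5 / 2)) *
    (Real.Gamma (3 / 2) / Real.Gamma 3) ^ (-(2 : ℝ) / 3)

open Real in
theorem Real.Gamma_five_halves : Gamma (5 / 2) = 3 / 4 * √π := by
  rw [show (5 / 2 : ℝ) = 1 / 2 + 1 + 1 by norm_num, Gamma_add_one (by norm_num),
    Gamma_add_one (by norm_num), Gamma_one_half_eq]
  ring

open Real in
theorem Real.Gamma_three_halves : Gamma (3 / 2) = √π / 2 := by
  rw [show (3 / 2 : ℝ) = 1 / 2 + 1 by norm_num, Gamma_add_one (by norm_num), Gamma_one_half_eq]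
  ring

open Real in
theorem Real.Gamma_three : Gamma 3 = 2 := by
  rw [show (3 : ℝ) = (2 : ℕ) + 1 by norm_num, Gamma_nat_eq_factorial]
  norm_num

open Real Set in
/-- The Gamma integral as a lower Lebesgue integral. -/
theorem lintegral_rpow_mul_exp_neg_mul {s r : ℝ} (hs : 0 < s) (hr : 0 < r) :
    ∫⁻ u in Ioi (0 : ℝ), ENNReal.ofReal (u ^ (s - 1) * exp (-(r * u))) =
      ENNReal.ofReal (Gamma s * r ^ (-s)) := by
  have hval : (1 / r) ^ s * Gamma s = Gamma s * r ^ (-s) := by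
    rw [one_div, inv_rpow hr.le, rpow_neg hr.le, mul_comm]
  have hint := integral_rpow_mul_exp_neg_mul_Ioi hs hr
  rw [hval] at hint
  rw [← hint, ofReal_integral_eq_lintegral_ofReal]
  · refine Integrable.of_integral_ne_zero ?_
    rw [hint]
    have := Gamma_pos_of_pos hs
    positivity
  · filter_upwards [ae_restrict_mem measurableSet_Ioi] with u hu
    have : 0 < u := hu
    simp only [Pi.zero_apply]
    positivity

open Real Set in
/-- Subordination: a negative power under an integral is a weighted integral of exponentials. -/
theorem ofReal_Gamma_mul_lintegral_rpow_neg {α : Type*} [MeasurableSpace α] {μ : Measure α}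
    [SFinite μ] {κ g : α → ℝ} {s : ℝ} (hs : 0 < s) (hκ : Measurable κ) (hg : Measurable g)
    (hκ0 : ∀ p, 0 ≤ κ p) (hg0 : ∀ᵐ p ∂μ, 0 < g p) :
    ENNReal.ofReal (Gamma s) * ∫⁻ p, ENNReal.ofReal (κ p * g p ^ (-s)) ∂μ =
      ∫⁻ u in Ioi (0 : ℝ), ENNReal.ofReal (u ^ (s - 1)) *
        ∫⁻ p, ENNReal.ofReal (κ p * exp (-(g p * u))) ∂μ := by
  have hΓ : 0 < Gamma s := Gamma_pos_of_pos hs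
  calc
    _ = ∫⁻ p, (∫⁻ u in Ioi (0 : ℝ),
          ENNReal.ofReal (u ^ (s - 1)) * ENNReal.ofReal (κ p * exp (-(g p * u)))) ∂μ := by
      rw [← lintegral_const_mul' _ _ ENNReal.ofReal_ne_top]
      refine lintegral_congr_ae ?_
      filter_upwards [hg0] with p hp
      rw [← ENNReal.ofReal_mul hΓ.le, show Gamma s * (κ p * g p ^ (-s)) =
        κ p * (Gamma s * g p ^ (-s)) by ring, ENNReal.ofReal_mul (hκ0 p),
        ← lintegral_rpow_mul_exp_neg_mul hs hp,
        ← lintegral_const_mul' _ _ ENNReal.ofReal_ne_top]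
      refine setLIntegral_congr_fun measurableSet_Ioi fun u hu => ?_
      have hu' : 0 < u := hu
      rw [← ENNReal.ofReal_mul (hκ0 p), ← ENNReal.ofReal_mul (by positivity)]
      ring_nf
    _ = _ := by
      rw [lintegral_lintegral_swap]
      · simp_rw [lintegral_const_mul' _ _ ENNReal.ofReal_ne_top]
      · unfold Function.uncurry
        fun_prop

open Real Set in
/-- Evaluation of an integral of a negative power from its Laplace representation. -/
theorem lintegral_mul_rpow_neg_eq {α : Type*} [MeasurableSpace α] {μ : Measure α}
    [SFinite μ] {κ g : α → ℝ} {Φ : ℝ → ℝ} {s R : ℝ} (hs : 0 < s) (hκ : Measurable κ)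
    (hg : Measurable g) (hκ0 : ∀ p, 0 ≤ κ p) (hg0 : ∀ᵐ p ∂μ, 0 < g p)
    (hΦ : ∀ u, 0 < u →
      ∫⁻ p, ENNReal.ofReal (κ p * exp (-(g p * u))) ∂μ = ENNReal.ofReal (Φ u))
    (hR : ∫⁻ u in Ioi (0 : ℝ), ENNReal.ofReal (u ^ (s - 1) * Φ u) =
      ENNReal.ofReal (Gamma s * R)) :
    ∫⁻ p, ENNReal.ofReal (κ p * g p ^ (-s)) ∂μ = ENNReal.ofReal R := by
  have hΓ : 0 < Gamma s := Gamma_pos_of_pos hs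
  have h := ofReal_Gamma_mul_lintegral_rpow_neg hs hκ hg hκ0 hg0
  rw [setLIntegral_congr_fun (g := fun u => ENNReal.ofReal (u ^ (s - 1) * Φ u))
    measurableSet_Ioi ?_, hR, ENNReal.ofReal_mul hΓ.le] at h
  · exact (ENNReal.mul_right_inj (by simpa using hΓ) ENNReal.ofReal_ne_top).1 h
  · intro u hu
    have hu' : 0 < u := hu
    simp only
    rw [hΦ u hu', ENNReal.ofReal_mul (by positivity)]

open Real Set in
/-- The Beta integral on the half line. -/
theorem lintegral_rpow_mul_add_rpow_neg {a b c : ℝ} (ha : 0 < a) (hab : a < b) (hc : 0 < c) :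
    ∫⁻ w in Ioi (0 : ℝ), ENNReal.ofReal (w ^ (a - 1) * (c + w) ^ (-b)) =
      ENNReal.ofReal (Gamma a * Gamma (b - a) / Gamma b * c ^ (a - b)) := by
  have hΓa : 0 < Gamma a := Gamma_pos_of_pos ha
  have hΓb : 0 < Gamma b := Gamma_pos_of_pos (ha.trans hab)
  have habs : ∫⁻ w in Ioi (0 : ℝ), ENNReal.ofReal (w ^ (a - 1) * (c + w) ^ (-b)) =
      ∫⁻ w in Ioi (0 : ℝ), ENNReal.ofReal (|w| ^ (a - 1) * (c + w) ^ (-b)) :=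
    setLIntegral_congr_fun measurableSet_Ioi fun w hw => by
      simp only [abs_of_pos (show 0 < w from hw)]
  rw [habs]
  refine lintegral_mul_rpow_neg_eq (Φ := fun u => exp (-(c * u)) * (Gamma a * u ^ (-a)))
    (ha.trans hab) (by fun_prop) (by fun_prop) (fun w => by positivity) ?_ ?_ ?_
  · filter_upwards [ae_restrict_mem measurableSet_Ioi] with w hw
    have : 0 < w := hw
    positivity
  · intro u hu
    rw [ENNReal.ofReal_mul (exp_pos _).le, ← lintegral_rpow_mul_exp_neg_mul ha hu,
      ← lintegral_const_mul' _ _ ENNReal.ofReal_ne_top]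
    refine setLIntegral_congr_fun measurableSet_Ioi fun w hw => ?_
    simp only [abs_of_pos (show 0 < w from hw)]
    rw [← ENNReal.ofReal_mul (exp_pos _).le, mul_left_comm, ← exp_add]
    ring_nf
  · rw [show Gamma b * (Gamma a * Gamma (b - a) / Gamma b * c ^ (a - b)) =
      Gamma a * (Gamma (b - a) * c ^ (-(b - a))) by rw [neg_sub]; field_simp,
      ENNReal.ofReal_mul hΓa.le, ← lintegral_rpow_mul_exp_neg_mul (sub_pos.2 hab) hc,
      ← lintegral_const_mul' _ _ ENNReal.ofReal_ne_top]
    refine setLIntegral_congr_fun measurableSet_Ioi fun u hu => ?_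
    have hu' : 0 < u := hu
    rw [← ENNReal.ofReal_mul hΓa.le, show b - a - 1 = (b - 1) + -a by ring, rpow_add hu']
    ring_nf

open Real in
theorem lintegral_exp_neg_mul_sq_norm {b : ℝ} (hb : 0 < b) :
    ∫⁻ x : EuclideanSpace ℝ (Fin 3), ENNReal.ofReal (exp (-(b * ‖x‖ ^ 2))) =
      ENNReal.ofReal ((π / b) ^ (3 / 2 : ℝ)) := by
  have hint := GaussianFourier.integral_rexp_neg_mul_sq_norm (V := EuclideanSpace ℝ (Fin 3)) hb
  simp only [finrank_euclideanSpace, Fintype.card_fin, Nat.cast_ofNat, neg_mul] at hint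
  rw [← hint, ofReal_integral_eq_lintegral_ofReal]
  · refine Integrable.of_integral_ne_zero ?_
    rw [hint]
    positivity
  · exact .of_forall fun x => (exp_pos _).le

open Real in
/-- The Gaussian integral of two coupled points. -/
theorem lintegral_exp_neg_coupled {u v t : ℝ} (hu : 0 < u) (hv : 0 < v) (ht : 0 < t) :
    ∫⁻ p : EuclideanSpace ℝ (Fin 3) × EuclideanSpace ℝ (Fin 3),
      ENNReal.ofReal (exp (-(u * ‖p.1‖ ^ 2 + v * ‖p.2‖ ^ 2 + t * ‖p.1 - p.2‖ ^ 2)))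
        ∂(volume.prod volume) =
      ENNReal.ofReal ((π ^ 2 / (u * v + (u + v) * t)) ^ (3 / 2 : ℝ)) := by
  have hsq (x y : EuclideanSpace ℝ (Fin 3)) :
      u * ‖x‖ ^ 2 + v * ‖y‖ ^ 2 + t * ‖x - y‖ ^ 2 =
        (u + v * t / (v + t)) * ‖x‖ ^ 2 + (v + t) * ‖y - (t / (v + t)) • x‖ ^ 2 := by
    rw [norm_sub_sq_real, norm_sub_sq_real, norm_smul, inner_smul_right, real_inner_comm,
      norm_of_nonneg (by positivity : 0 ≤ t / (v + t))]
    field_simp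
    ring
  have hinner (x : EuclideanSpace ℝ (Fin 3)) :
      ∫⁻ y : EuclideanSpace ℝ (Fin 3),
        ENNReal.ofReal (exp (-(u * ‖x‖ ^ 2 + v * ‖y‖ ^ 2 + t * ‖x - y‖ ^ 2))) =
      ENNReal.ofReal ((π / (v + t)) ^ (3 / 2 : ℝ)) *
        ENNReal.ofReal (exp (-((u + v * t / (v + t)) * ‖x‖ ^ 2))) := by
    simp_rw [hsq, neg_add, exp_add, ENNReal.ofReal_mul (exp_pos _).le]
    rw [lintegral_const_mul' _ _ ENNReal.ofReal_ne_top,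
      lintegral_sub_right_eq_self
        (fun y : EuclideanSpace ℝ (Fin 3) => ENNReal.ofReal (exp (-((v + t) * ‖y‖ ^ 2)))),
      lintegral_exp_neg_mul_sq_norm (by positivity), mul_comm]
  rw [lintegral_prod _ (by fun_prop)]
  simp_rw [hinner]
  rw [lintegral_const_mul' _ _ ENNReal.ofReal_ne_top,
    lintegral_exp_neg_mul_sq_norm (by positivity), ← ENNReal.ofReal_mul (by positivity),
    ← mul_rpow (by positivity) (by positivity)]
  congr 2
  field_simp
  ring

open Real Set in
/-- The Newtonian interaction energy of two centered Gaussians. -/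
theorem lintegral_gaussian_newton {u v : ℝ} (hu : 0 < u) (hv : 0 < v) :
    ∫⁻ p : EuclideanSpace ℝ (Fin 3) × EuclideanSpace ℝ (Fin 3),
      ENNReal.ofReal (exp (-(u * ‖p.1‖ ^ 2 + v * ‖p.2‖ ^ 2)) * ‖p.1 - p.2‖ ^ (-(1 : ℝ)))
        ∂(volume.prod volume) =
      ENNReal.ofReal (2 * π ^ 3 / √π * ((u * v)⁻¹ * (u + v) ^ (-(1 / 2) : ℝ))) := by
  have hpow (x : EuclideanSpace ℝ (Fin 3)) :
      ‖x‖ ^ (-(1 : ℝ)) = (‖x‖ ^ 2) ^ (-(1 / 2) : ℝ) := by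
    rw [← rpow_natCast, ← rpow_mul (norm_nonneg x)]
    norm_num
  simp_rw [hpow]
  refine lintegral_mul_rpow_neg_eq
    (Φ := fun t => (π ^ 2 / (u * v + (u + v) * t)) ^ (3 / 2 : ℝ))
    (by norm_num) (by fun_prop) (by fun_prop) (fun p => (exp_pos _).le) ?_ ?_ ?_
  · rw [Measure.ae_prod_iff_ae_ae (measurableSet_lt (by fun_prop) (by fun_prop))]
    refine .of_forall fun x => ?_
    filter_upwards [Measure.ae_ne volume x] with y hy
    have : 0 < ‖x - y‖ := norm_pos_iff.2 (sub_ne_zero.2 hy.symm)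
    positivity
  · intro t ht
    rw [← lintegral_exp_neg_coupled hu hv ht]
    refine lintegral_congr fun p => ?_
    rw [← exp_add]
    ring_nf
  · have hA : 0 < u * v / (u + v) := by positivity
    have hπ3 : (π ^ 2) ^ (3 / 2 : ℝ) = π ^ 3 := by
      rw [← rpow_natCast, ← rpow_mul pi_pos.le, ← rpow_natCast]
      norm_num
    have hbeta := lintegral_rpow_mul_add_rpow_neg (a := 1 / 2) (b := 3 / 2) (by norm_num)
      (by norm_num) hA
    calc
      _ = ∫⁻ t in Ioi (0 : ℝ), ENNReal.ofReal (π ^ 3 * (u + v) ^ (-(3 / 2) : ℝ)) *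
          ENNReal.ofReal (t ^ ((1 / 2 : ℝ) - 1) *
            (u * v / (u + v) + t) ^ (-(3 / 2) : ℝ)) := by
        refine setLIntegral_congr_fun measurableSet_Ioi fun t ht => ?_
        have ht' : 0 < t := ht
        rw [← ENNReal.ofReal_mul (by positivity),
          show u * v + (u + v) * t = (u + v) * (u * v / (u + v) + t) by field_simp,
          div_rpow (by positivity) (by positivity), mul_rpow (by positivity) (by positivity),
          hπ3, rpow_neg (by positivity), rpow_neg (by positivity)]
        congr 1
        field_simp
      _ = _ := by
        rw [lintegral_const_mul' _ _ ENNReal.ofReal_ne_top, hbeta,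
          ← ENNReal.ofReal_mul (by positivity)]
        congr 1
        have h3 : (u + v) ^ (-(3 / 2) : ℝ) = (u + v) ^ (-(1 / 2) : ℝ) * (u + v)⁻¹ := by
          rw [← rpow_neg_one (u + v), ← rpow_add (by positivity)]
          norm_num
        rw [show (1 / 2 - 3 / 2 : ℝ) = -1 by norm_num, rpow_neg_one,
          show (3 / 2 - 1 / 2 : ℝ) = 1 by norm_num, Gamma_one, Gamma_three_halves, Gamma_one_half_eq, h3]
        have := sqrt_pos.2 pi_pos
        field_simp

open Real Set in
theorem lintegral_exp_neg_mul_sqrt_mul {c : ℝ} (hc : 0 < c) :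
    ∫⁻ q : ℝ × ℝ, ENNReal.ofReal (|q.1| ^ (1 / 2 : ℝ) * |q.2| ^ (1 / 2 : ℝ) *
        exp (-(c * (q.1 + q.2))) * (q.1 + q.2) ^ (-(1 / 2) : ℝ))
        ∂((volume.restrict (Ioi 0)).prod (volume.restrict (Ioi 0))) =
      ENNReal.ofReal (3 * π * √π / 32 * c ^ (-(5 / 2) : ℝ)) := by
  refine lintegral_mul_rpow_neg_eq
    (Φ := fun w => (√π / 2 * (c + w) ^ (-(3 / 2) : ℝ)) ^ 2)
    (by norm_num) (by fun_prop) (by fun_prop) (fun q => by positivity) ?_ ?_ ?_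
  · rw [Measure.ae_prod_iff_ae_ae (measurableSet_lt (by fun_prop) (by fun_prop))]
    filter_upwards [ae_restrict_mem measurableSet_Ioi] with x hx
    filter_upwards [ae_restrict_mem measurableSet_Ioi] with y hy
    exact add_pos hx hy
  · intro w hw
    have h1 : ∫⁻ x in Ioi (0 : ℝ), ENNReal.ofReal (|x| ^ (1 / 2 : ℝ) * exp (-((c + w) * x))) =
        ENNReal.ofReal (√π / 2 * (c + w) ^ (-(3 / 2) : ℝ)) := by
      rw [← Gamma_three_halves,
        ← lintegral_rpow_mul_exp_neg_mul (by norm_num) (by positivity : 0 < c + w)]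
      refine setLIntegral_congr_fun measurableSet_Ioi fun x hx => ?_
      simp only [abs_of_pos (show 0 < x from hx)]
      norm_num
    rw [ENNReal.ofReal_pow (by positivity), sq, ← h1,
      ← lintegral_prod_mul (by fun_prop) (by fun_prop)]
    refine lintegral_congr fun q => ?_
    rw [← ENNReal.ofReal_mul (by positivity), mul_assoc, ← exp_add, mul_mul_mul_comm, ← exp_add]
    ring_nf
  · have hbeta := lintegral_rpow_mul_add_rpow_neg (a := 1 / 2) (b := 3) (by norm_num)
      (by norm_num) hc
    calc
      _ = ∫⁻ w in Ioi (0 : ℝ), ENNReal.ofReal (π / 4) *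
          ENNReal.ofReal (w ^ ((1 / 2 : ℝ) - 1) * (c + w) ^ (-3 : ℝ)) := by
        refine setLIntegral_congr_fun measurableSet_Ioi fun w hw => ?_
        have hw' : 0 < w := hw
        rw [← ENNReal.ofReal_mul (by positivity), mul_pow, div_pow, sq_sqrt pi_pos.le,
          ← rpow_natCast ((c + w) ^ _) 2,
          ← rpow_mul (by positivity)]
        norm_num
        ring_nf
      _ = _ := by
        rw [lintegral_const_mul' _ _ ENNReal.ofReal_ne_top, hbeta,
          ← ENNReal.ofReal_mul (by positivity)]
        congr 1
        rw [show (3 - 1 / 2 : ℝ) = 5 / 2 by norm_num, Gamma_five_halves, Gamma_three,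
          Gamma_one_half_eq, show (1 / 2 - 3 : ℝ) = -(5 / 2) by norm_num]
        ring_nf

open Real Set in
/-- The Newtonian self-energy of the unnormalized Plummer profile. -/
theorem lintegral_plummer_newton {c : ℝ} (hc : 0 < c) :
    ∫⁻ p : EuclideanSpace ℝ (Fin 3) × EuclideanSpace ℝ (Fin 3),
      ENNReal.ofReal ((c + ‖p.1‖ ^ 2) ^ (-(5 / 2) : ℝ) * (c + ‖p.2‖ ^ 2) ^ (-(5 / 2) : ℝ) *
        ‖p.1 - p.2‖ ^ (-(1 : ℝ))) ∂(volume.prod volume) =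
      ENNReal.ofReal (π ^ 3 / 3 * c ^ (-(5 / 2) : ℝ)) := by
  have hΓ : 0 < Gamma (5 / 2) := Gamma_pos_of_pos (by norm_num)
  have hπ : 0 < √π := sqrt_pos.2 pi_pos
  have hfirst := ofReal_Gamma_mul_lintegral_rpow_neg
    (μ := (volume.prod volume : Measure
      (EuclideanSpace ℝ (Fin 3) × EuclideanSpace ℝ (Fin 3))))
    (κ := fun p => (c + ‖p.2‖ ^ 2) ^ (-(5 / 2) : ℝ) * ‖p.1 - p.2‖ ^ (-(1 : ℝ)))
    (g := fun p => c + ‖p.1‖ ^ 2) (s := 5 / 2) (by norm_num) (by fun_prop) (by fun_prop)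
    (fun p => by positivity) (.of_forall fun p => by positivity)
  have hsecond (u : ℝ) := ofReal_Gamma_mul_lintegral_rpow_neg
    (μ := (volume.prod volume : Measure
      (EuclideanSpace ℝ (Fin 3) × EuclideanSpace ℝ (Fin 3))))
    (κ := fun p => ‖p.1 - p.2‖ ^ (-(1 : ℝ)) * exp (-((c + ‖p.1‖ ^ 2) * u)))
    (g := fun p => c + ‖p.2‖ ^ 2) (s := 5 / 2) (by norm_num) (by fun_prop) (by fun_prop)
    (fun p => by positivity) (.of_forall fun p => by positivity)
  have hgauss {u v : ℝ} (hu : 0 < u) (hv : 0 < v) :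
      ∫⁻ p : EuclideanSpace ℝ (Fin 3) × EuclideanSpace ℝ (Fin 3),
        ENNReal.ofReal (‖p.1 - p.2‖ ^ (-(1 : ℝ)) * exp (-((c + ‖p.1‖ ^ 2) * u)) *
          exp (-((c + ‖p.2‖ ^ 2) * v))) ∂(volume.prod volume) =
      ENNReal.ofReal (2 * π ^ 3 / √π *
        (exp (-(c * (u + v))) * ((u * v)⁻¹ * (u + v) ^ (-(1 / 2) : ℝ)))) := by
    rw [mul_left_comm, ENNReal.ofReal_mul (exp_pos _).le, ← lintegral_gaussian_newton hu hv,
      ← lintegral_const_mul' _ _ ENNReal.ofReal_ne_top]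
    refine lintegral_congr fun p => ?_
    rw [← ENNReal.ofReal_mul (exp_pos _).le, mul_assoc, ← exp_add, ← mul_assoc, ← exp_add,
      mul_comm]
    ring_nf
  have hweight {u : ℝ} (hu : 0 < u) : u ^ ((5 / 2 : ℝ) - 1) = u ^ (1 / 2 : ℝ) * u := by
    rw [← rpow_add_one hu.ne']
    norm_num
  have hinner {u : ℝ} (hu : 0 < u) :
      ENNReal.ofReal (Gamma (5 / 2)) * (ENNReal.ofReal (u ^ ((5 / 2 : ℝ) - 1)) *
        ∫⁻ p : EuclideanSpace ℝ (Fin 3) × EuclideanSpace ℝ (Fin 3),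
          ENNReal.ofReal ((c + ‖p.2‖ ^ 2) ^ (-(5 / 2) : ℝ) * ‖p.1 - p.2‖ ^ (-(1 : ℝ)) *
            exp (-((c + ‖p.1‖ ^ 2) * u))) ∂(volume.prod volume)) =
      ∫⁻ v in Ioi (0 : ℝ), ENNReal.ofReal (2 * π ^ 3 / √π) *
        ENNReal.ofReal (|u| ^ (1 / 2 : ℝ) * |v| ^ (1 / 2 : ℝ) *
          exp (-(c * (u + v))) * (u + v) ^ (-(1 / 2) : ℝ)) := by
    have hcomm (p : EuclideanSpace ℝ (Fin 3) × EuclideanSpace ℝ (Fin 3)) :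
        (c + ‖p.2‖ ^ 2) ^ (-(5 / 2) : ℝ) * ‖p.1 - p.2‖ ^ (-(1 : ℝ)) *
            exp (-((c + ‖p.1‖ ^ 2) * u)) =
          ‖p.1 - p.2‖ ^ (-(1 : ℝ)) * exp (-((c + ‖p.1‖ ^ 2) * u)) *
            (c + ‖p.2‖ ^ 2) ^ (-(5 / 2) : ℝ) := by ring
    simp_rw [hcomm]
    rw [mul_left_comm, hsecond u, ← lintegral_const_mul' _ _ ENNReal.ofReal_ne_top]
    refine setLIntegral_congr_fun measurableSet_Ioi fun v hv => ?_
    have hv' : 0 < v := hv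
    rw [hgauss hu hv', ← ENNReal.ofReal_mul (by positivity), ← ENNReal.ofReal_mul (by positivity),
      ← ENNReal.ofReal_mul (by positivity), hweight hu, hweight hv', abs_of_pos hu,
      abs_of_pos hv']
    congr 1
    field_simp
  have hcomm (p : EuclideanSpace ℝ (Fin 3) × EuclideanSpace ℝ (Fin 3)) :
      (c + ‖p.1‖ ^ 2) ^ (-(5 / 2) : ℝ) * (c + ‖p.2‖ ^ 2) ^ (-(5 / 2) : ℝ) *
          ‖p.1 - p.2‖ ^ (-(1 : ℝ)) =
        (c + ‖p.2‖ ^ 2) ^ (-(5 / 2) : ℝ) * ‖p.1 - p.2‖ ^ (-(1 : ℝ)) *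
          (c + ‖p.1‖ ^ 2) ^ (-(5 / 2) : ℝ) := by ring
  simp_rw [hcomm]
  refine (ENNReal.mul_right_inj (a := ENNReal.ofReal (Gamma (5 / 2))) (by simpa using hΓ)
    ENNReal.ofReal_ne_top).1 ((ENNReal.mul_right_inj (a := ENNReal.ofReal (Gamma (5 / 2)))
      (by simpa using hΓ) ENNReal.ofReal_ne_top).1 ?_)
  rw [hfirst, ← lintegral_const_mul' _ _ ENNReal.ofReal_ne_top,
    setLIntegral_congr_fun measurableSet_Ioi fun u hu => hinner hu]
  simp_rw [lintegral_const_mul' _ _ (ENNReal.ofReal_ne_top (r := 2 * π ^ 3 / √π))]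
  rw [← lintegral_prod (fun q : ℝ × ℝ => ENNReal.ofReal (|q.1| ^ (1 / 2 : ℝ) *
      |q.2| ^ (1 / 2 : ℝ) * exp (-(c * (q.1 + q.2))) * (q.1 + q.2) ^ (-(1 / 2) : ℝ)))
      (by fun_prop), lintegral_exp_neg_mul_sqrt_mul hc, ← ENNReal.ofReal_mul (by positivity),
    ← ENNReal.ofReal_mul hΓ.le, ← ENNReal.ofReal_mul hΓ.le, Gamma_five_halves]
  congr 1
  field_simp
  rw [sq_sqrt pi_pos.le]
  ring

open Real Set in
theorem lintegral_add_sq_norm_rpow_neg_three {c : ℝ} (hc : 0 < c) :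
    ∫⁻ x : EuclideanSpace ℝ (Fin 3), ENNReal.ofReal ((c + ‖x‖ ^ 2) ^ (-3 : ℝ)) =
      ENNReal.ofReal (π ^ 2 / 4 * c ^ (-(3 / 2) : ℝ)) := by
  have h := lintegral_mul_rpow_neg_eq
    (μ := (volume : Measure (EuclideanSpace ℝ (Fin 3)))) (κ := fun _ => 1)
    (g := fun x => c + ‖x‖ ^ 2) (s := 3)
    (Φ := fun u => exp (-(c * u)) * (π / u) ^ (3 / 2 : ℝ))
    (R := π ^ 2 / 4 * c ^ (-(3 / 2) : ℝ)) (by norm_num) (by fun_prop) (by fun_prop)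
    (fun _ => zero_le_one) (.of_forall fun x => by positivity) ?_ ?_
  · simpa using h
  · intro u hu
    rw [ENNReal.ofReal_mul (exp_pos _).le, ← lintegral_exp_neg_mul_sq_norm hu,
      ← lintegral_const_mul' _ _ ENNReal.ofReal_ne_top]
    refine lintegral_congr fun x => ?_
    rw [← ENNReal.ofReal_mul (exp_pos _).le, one_mul, ← exp_add]
    ring_nf
  · have hπ : π ^ (3 / 2 : ℝ) = π * √π := by
      rw [sqrt_eq_rpow, ← rpow_one_add' pi_pos.le (by norm_num)]
      norm_num
    rw [Gamma_three, show 2 * (π ^ 2 / 4 * c ^ (-(3 / 2) : ℝ)) =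
      π ^ (3 / 2 : ℝ) * (Gamma (3 / 2) * c ^ (-(3 / 2) : ℝ)) by
        rw [hπ, Gamma_three_halves]
        linear_combination (-(π * c ^ (-(3 / 2) : ℝ)) / 2) * sq_sqrt pi_pos.le,
      ENNReal.ofReal_mul (by positivity), ← lintegral_rpow_mul_exp_neg_mul (by norm_num) hc,
      ← lintegral_const_mul' _ _ ENNReal.ofReal_ne_top]
    refine setLIntegral_congr_fun measurableSet_Ioi fun u hu => ?_
    have hu' : 0 < u := hu
    rw [← ENNReal.ofReal_mul (by positivity), div_rpow pi_pos.le hu'.le,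
      show (3 / 2 - 1 : ℝ) = 3 - 1 - 3 / 2 by norm_num, rpow_sub hu' (3 - 1)]
    ring_nf

open Real in
theorem C31_eq : C31 = 4 / 3 * (π / 16) ^ (-(1 / 3) : ℝ) := by
  have hπ : 0 < √π := sqrt_pos.2 pi_pos
  rw [C31, Gamma_one, Gamma_five_halves, Gamma_three_halves, Gamma_three, ← sqrt_eq_rpow,
    show √π / 2 / 2 = (π / 16) ^ (1 / 2 : ℝ) by
      rw [← sqrt_eq_rpow, sqrt_div pi_pos.le, show (16 : ℝ) = 4 ^ 2 by norm_num,
        sqrt_sq (by norm_num)]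
      ring,
    ← rpow_mul (by positivity), show (1 / 2 * (-2 / 3) : ℝ) = -(1 / 3) by norm_num]
  field_simp

/-- Equality in the three-dimensional gravitational entropic bound holds for
the Plummer profile `ρ(x) = (3M/(4πγ³)) (1 + |x|²/γ²)^{−5/2}`:
`G ∬ ρ(x) ρ(y) |x−y|^{−1} dx dy = C(3,1) G M² (1 − (1/5) S_{6/5}[ρ/M])^{5/3}`,
where `S_q[f] = (1/(q−1))(1 − ∫ f^q)` is the Tsallis entropy. -/
theorem plummer_achieves_entropic_bound
    (G M γ : ℝ) (hG : 0 < G) (hM : 0 < M) (hγ : 0 < γ)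
    (ρ : EuclideanSpace ℝ (Fin 3) → ℝ)
    (hρ : ρ = fun x =>
      (3 * M / (4 * Real.pi * γ ^ 3)) * (1 + ‖x‖ ^ 2 / γ ^ 2) ^ (-(5 : ℝ) / 2)) :
    G * ∫ p : EuclideanSpace ℝ (Fin 3) × EuclideanSpace ℝ (Fin 3),
          ρ p.1 * ρ p.2 * ‖p.1 - p.2‖ ^ (-(1 : ℝ)) ∂(volume.prod volume) =
      C31 * G * M ^ 2 *
        (1 - (1 / 5) *
          ((1 / ((6 : ℝ) / 5 - 1)) * (1 - ∫ x, (ρ x / M) ^ ((6 : ℝ) / 5)))) ^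
          ((5 : ℝ) / 3) := by
  have hπ := Real.pi_pos
  have hγpow (s : ℝ) : (γ ^ 2) ^ s = γ ^ (2 * s) := by
    rw [← Real.rpow_natCast, ← Real.rpow_mul hγ.le]
    norm_num
  have h5 : (γ ^ 2) ^ (-(5 / 2) : ℝ) = (γ ^ 5)⁻¹ := by
    rw [hγpow, ← Real.rpow_natCast γ 5, ← Real.rpow_neg hγ.le]
    norm_num
  have hρ' (x : EuclideanSpace ℝ (Fin 3)) :
      ρ x = 3 * M * γ ^ 2 / (4 * Real.pi) * (γ ^ 2 + ‖x‖ ^ 2) ^ (-(5 / 2) : ℝ) := by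
    rw [hρ, show γ ^ 2 + ‖x‖ ^ 2 = γ ^ 2 * (1 + ‖x‖ ^ 2 / γ ^ 2) by field_simp,
      Real.mul_rpow (by positivity) (by positivity), h5, neg_div]
    field_simp
  have henergy : ∫ p : EuclideanSpace ℝ (Fin 3) × EuclideanSpace ℝ (Fin 3),
      ρ p.1 * ρ p.2 * ‖p.1 - p.2‖ ^ (-(1 : ℝ)) ∂(volume.prod volume) =
        3 * Real.pi * M ^ 2 / (16 * γ) := by
    have hcomm (p : EuclideanSpace ℝ (Fin 3) × EuclideanSpace ℝ (Fin 3)) :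
        ρ p.1 * ρ p.2 * ‖p.1 - p.2‖ ^ (-(1 : ℝ)) = (3 * M * γ ^ 2 / (4 * Real.pi)) ^ 2 *
          ((γ ^ 2 + ‖p.1‖ ^ 2) ^ (-(5 / 2) : ℝ) * (γ ^ 2 + ‖p.2‖ ^ 2) ^ (-(5 / 2) : ℝ) *
            ‖p.1 - p.2‖ ^ (-(1 : ℝ))) := by
      rw [hρ', hρ']
      ring
    simp_rw [hcomm]
    rw [integral_const_mul, integral_eq_lintegral_of_nonneg_ae
        (.of_forall fun p => by simp only [Pi.zero_apply]; positivity)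
        (Measurable.aestronglyMeasurable (by fun_prop)),
      lintegral_plummer_newton (by positivity), ENNReal.toReal_ofReal (by positivity), h5]
    field_simp
    ring
  have hentropy : ∫ x, (ρ x / M) ^ ((6 : ℝ) / 5) =
      (3 * γ ^ 2 / (4 * Real.pi)) ^ (6 / 5 : ℝ) * (Real.pi ^ 2 / 4 * (γ ^ 3)⁻¹) := by
    have h3 : (γ ^ 2) ^ (-(3 / 2) : ℝ) = (γ ^ 3)⁻¹ := by
      rw [hγpow, ← Real.rpow_natCast γ 3, ← Real.rpow_neg hγ.le]
      norm_num
    have hpow (x : EuclideanSpace ℝ (Fin 3)) : (ρ x / M) ^ ((6 : ℝ) / 5) =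
        (3 * γ ^ 2 / (4 * Real.pi)) ^ (6 / 5 : ℝ) * (γ ^ 2 + ‖x‖ ^ 2) ^ (-3 : ℝ) := by
      rw [hρ', show 3 * M * γ ^ 2 / (4 * Real.pi) * (γ ^ 2 + ‖x‖ ^ 2) ^ (-(5 / 2) : ℝ) / M =
        3 * γ ^ 2 / (4 * Real.pi) * (γ ^ 2 + ‖x‖ ^ 2) ^ (-(5 / 2) : ℝ) by field_simp,
        Real.mul_rpow (by positivity) (by positivity), ← Real.rpow_mul (by positivity)]
      norm_num
    simp_rw [hpow]
    rw [integral_const_mul, integral_eq_lintegral_of_nonneg_ae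
        (.of_forall fun p => by simp only [Pi.zero_apply]; positivity)
        (Measurable.aestronglyMeasurable (by fun_prop)),
      lintegral_add_sq_norm_rpow_neg_three (by positivity),
      ENNReal.toReal_ofReal (by positivity), h3]
  have hγ5 : ((γ ^ 3)⁻¹ : ℝ) ^ (5 / 3 : ℝ) = (γ ^ 5)⁻¹ := by
    rw [Real.inv_rpow (by positivity), ← Real.rpow_natCast γ 3, ← Real.rpow_mul hγ.le,
      ← Real.rpow_natCast γ 5]
    norm_num
  have hconst : (Real.pi / 16) ^ (-(1 / 3) : ℝ) * (Real.pi ^ 2 / 4) ^ (5 / 3 : ℝ) =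
      Real.pi ^ 3 / 4 := by
    rw [Real.rpow_neg (by positivity), ← Real.inv_rpow (by positivity),
      show (5 / 3 : ℝ) = (5 : ℕ) * (1 / 3) by norm_num, Real.rpow_mul (by positivity),
      Real.rpow_natCast, ← Real.mul_rpow (by positivity) (by positivity),
      show (Real.pi / 16)⁻¹ * (Real.pi ^ 2 / 4) ^ 5 = (Real.pi ^ 3 / 4) ^ 3 by field_simp; ring,
      ← Real.rpow_natCast, ← Real.rpow_mul (by positivity)]
    norm_num
  rw [henergy, hentropy, C31_eq,
    show (1 : ℝ) - 1 / 5 * (1 / (6 / 5 - 1) * (1 - (3 * γ ^ 2 / (4 * Real.pi)) ^ (6 / 5 : ℝ) *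
      (Real.pi ^ 2 / 4 * (γ ^ 3)⁻¹))) =
      (3 * γ ^ 2 / (4 * Real.pi)) ^ (6 / 5 : ℝ) * (Real.pi ^ 2 / 4 * (γ ^ 3)⁻¹) by ring,
    Real.mul_rpow (by positivity) (by positivity), Real.mul_rpow (by positivity) (by positivity),
    ← Real.rpow_mul (by positivity), hγ5, show (6 / 5 * (5 / 3) : ℝ) = (2 : ℕ) by norm_num,
    Real.rpow_natCast]
  rw [show 4 / 3 * (Real.pi / 16) ^ (-(1 / 3) : ℝ) * G * M ^ 2 *
      ((3 * γ ^ 2 / (4 * Real.pi)) ^ 2 * ((Real.pi ^ 2 / 4) ^ (5 / 3 : ℝ) * (γ ^ 5)⁻¹)) =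
      4 / 3 * G * M ^ 2 * (3 * γ ^ 2 / (4 * Real.pi)) ^ 2 * (γ ^ 5)⁻¹ *
        ((Real.pi / 16) ^ (-(1 / 3) : ℝ) * (Real.pi ^ 2 / 4) ^ (5 / 3 : ℝ)) by ring, hconst]
  field_simp
  ring
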